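/- For every real c with (10−√17)/83 < c < 1/11, set a = (1 + 10c − 3√(108c² − 20c + 1))/4 and b = (1 − 10c + √(108c² − 20c + 1))/4. Then the 9×9 diagonal matrix diag(a, b, b, b, c, c, c, c, c) is an extreme point of AP_{3,3}. -/

import Mathlib

open Matrix ComplexOrder

noncomputable section

/-- Index type for a two-qutrit system. -/
abbrev QIdx : Type := Fin 3 × Fin 3

/-- Partial transpose: `PT M ((i,j),(k,l)) = M ((i,l),(k,j))`. -/
def PT (M : Matrix QIdx QIdx ℂ) : Matrix QIdx QIdx ℂ :=
  fun p q => M (p.1, q.2) (q.1, p.2)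

/-- The set of absolutely PPT two-qutrit states. -/
def AP33 : Set (Matrix QIdx QIdx ℂ) :=
  {ρ | ρ.PosSemidef ∧ ρ.trace = 1 ∧
    ∀ U : Matrix QIdx QIdx ℂ, U ∈ Matrix.unitaryGroup QIdx ℂ →
      (PT (U * ρ * Uᴴ)).PosSemidef}

/-- The 9×9 diagonal matrix with prescribed real diagonal entries
(listed in order), regarded as a matrix indexed by `QIdx`. -/
def diag9 (d : Fin 9 → ℝ) : Matrix QIdx QIdx ℂ :=
  Matrix.diagonal fun p => ((d ((finProdFinEquiv.trans (finCongr (by norm_num))) p) : ℝ) : ℂ)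

/-- Singular value decomposition of a square complex matrix. -/
theorem exists_singular_value_decomposition {n : Type*} [Fintype n] [LinearOrder n]
    [LocallyFiniteOrderBot n] [WellFoundedLT n] (A : Matrix n n ℂ) :
    ∃ (s : n → ℝ) (U V : Matrix n n ℂ), (∀ i, 0 ≤ s i) ∧ U ∈ unitaryGroup n ℂ ∧
      V ∈ unitaryGroup n ℂ ∧ A = U * diagonal (fun i => (s i : ℂ)) * Vᴴ := by
  have hH : (Aᴴ * A).IsHermitian := isHermitian_conjTranspose_mul_self A
  obtain ⟨V, hV⟩ : ∃ V : Matrix n n ℂ, V = hH.eigenvectorUnitary := ⟨_, rfl⟩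
  have hVm : V ∈ unitaryGroup n ℂ := hV ▸ hH.eigenvectorUnitary.2
  have hVV : V * Vᴴ = 1 := mem_unitaryGroup_iff.1 hVm
  have hdiag : (A * V)ᴴ * (A * V) = diagonal (RCLike.ofReal ∘ hH.eigenvalues) := by
    rw [← hH.conjStarAlgAut_star_eigenvectorUnitary, Unitary.conjStarAlgAut_apply]
    simp [hV, star_eq_conjTranspose, Matrix.mul_assoc]
  let f : n → EuclideanSpace ℂ n := fun j => WithLp.toLp 2 (fun i => (A * V) i j)
  have hf : Pairwise fun i j => inner ℂ (f i) (f j) = 0 := by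
    intro i j hij
    have h := congrFun (congrFun hdiag i) j
    rw [diagonal_apply_ne _ hij] at h
    rw [← h, Matrix.mul_apply]
    simp [f, PiLp.inner_apply, mul_comm]
  let b := InnerProductSpace.gramSchmidtOrthonormalBasis (𝕜 := ℂ) (by simp) f
  have hb : ∀ j, f j = (‖f j‖ : ℂ) • b j := by
    intro j
    by_cases h : f j = 0
    · simp [h]
    · simp only [b]
      rw [InnerProductSpace.gramSchmidtOrthonormalBasis_apply_of_orthogonal (𝕜 := ℂ) (by simp) hf h,
        smul_smul]
      change f j = ((‖f j‖ : ℂ) * (‖f j‖ : ℂ)⁻¹) • f j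
      rw [mul_inv_cancel₀ (by simpa using h), one_smul]
  refine ⟨fun j => ‖f j‖, (EuclideanSpace.basisFun n ℂ).toBasis.toMatrix b, V,
    fun j => norm_nonneg _, ?_, hVm, ?_⟩
  · exact (EuclideanSpace.basisFun n ℂ).toMatrix_orthonormalBasis_mem_unitary b
  · have h : A * V = (EuclideanSpace.basisFun n ℂ).toBasis.toMatrix b *
        diagonal (fun j => (‖f j‖ : ℂ)) := by
      ext i j
      have h2 := congrArg (fun v : EuclideanSpace ℂ n => v i) (hb j)
      rw [mul_diagonal]
      simpa [f, Module.Basis.toMatrix_apply, mul_comm] using h2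
    rw [← h, Matrix.mul_assoc, hVV, Matrix.mul_one]

/-- Schmidt decomposition of a two-qutrit vector, with decreasing Schmidt coefficients. -/
theorem exists_schmidt_decomposition (φ : QIdx → ℂ) :
    ∃ (s : Fin 3 → ℝ) (U V : Matrix (Fin 3) (Fin 3) ℂ), 0 ≤ s 2 ∧ s 2 ≤ s 1 ∧ s 1 ≤ s 0 ∧
      U ∈ unitaryGroup (Fin 3) ℂ ∧ V ∈ unitaryGroup (Fin 3) ℂ ∧
      ∀ i j, φ (i, j) = ∑ r, (s r : ℂ) * U i r * star (V j r) := by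
  obtain ⟨s, U, V, hs, hU, hV, h⟩ :=
    exists_singular_value_decomposition (Matrix.of fun i j => φ (i, j))
  let e : Equiv.Perm (Fin 3) := Tuple.sort (fun i => - s i)
  have hmono : ∀ i j, i ≤ j → s (e j) ≤ s (e i) := fun i j hij =>
    neg_le_neg_iff.1 (Tuple.monotone_sort (fun i => - s i) hij)
  have hsub : ∀ W ∈ unitaryGroup (Fin 3) ℂ, W.submatrix id e ∈ unitaryGroup (Fin 3) ℂ := by
    intro W hW
    rw [mem_unitaryGroup_iff, star_eq_conjTranspose] at hW ⊢
    rw [conjTranspose_submatrix, submatrix_mul_equiv, hW, submatrix_id_id]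
  refine ⟨s ∘ e, U.submatrix id e, V.submatrix id e, hs _, hmono _ _ (by decide),
    hmono _ _ (by decide), hsub U hU, hsub V hV, fun i j => ?_⟩
  have h2 := congrFun (congrFun h i) j
  simp only [of_apply] at h2
  rw [h2, Matrix.mul_apply]
  simp only [mul_diagonal, conjTranspose_apply, Function.comp_apply, submatrix_apply, id_eq]
  rw [Equiv.sum_comp e (fun r => (s r : ℂ) * U i r * star (V j r))]
  exact Finset.sum_congr rfl fun r _ => by ring

/-- Quadratic form of a partial transpose in terms of a Schmidt decomposition. -/
theorem quadForm_PT_schmidt (M : Matrix QIdx QIdx ℂ) (s : Fin 3 → ℝ)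
    (U V : Matrix (Fin 3) (Fin 3) ℂ) (φ : QIdx → ℂ)
    (hφ : ∀ i j, φ (i, j) = ∑ r, (s r : ℂ) * U i r * star (V j r)) :
    star φ ⬝ᵥ PT M *ᵥ φ =
      ∑ r, ∑ t, (s r * s t : ℂ) * ((kroneckerMap (· * ·) U V)ᴴ * M *
        kroneckerMap (· * ·) U V) (r, t) (t, r) := by
  let e : QIdx × QIdx ≃ QIdx × QIdx :=
    { toFun := fun x => ((x.2.1, x.1.2), (x.1.1, x.2.2))
      invFun := fun x => ((x.2.1, x.1.2), (x.1.1, x.2.2))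
      left_inv := fun _ => rfl
      right_inv := fun _ => rfl }
  have hE : ∀ r t, ((kroneckerMap (· * ·) U V)ᴴ * M * kroneckerMap (· * ·) U V) (r, t) (t, r) =
      ∑ x : QIdx × QIdx, star (U x.1.1 r) * V x.1.2 r * PT M x.1 x.2 *
        (U x.2.1 t * star (V x.2.2 t)) := by
    intro r t
    simp only [Matrix.mul_apply, Finset.sum_mul, conjTranspose_apply, kroneckerMap_apply, star_mul']
    rw [← Fintype.sum_prod_type']
    refine (Fintype.sum_equiv e _ _ fun x => ?_).symm
    simp only [e, PT, Equiv.coe_fn_mk]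
    ring
  simp_rw [hE, Finset.mul_sum]
  rw [Finset.sum_congr rfl fun r _ => Finset.sum_comm, Finset.sum_comm]
  simp only [dotProduct, mulVec, Finset.mul_sum]
  rw [← Fintype.sum_prod_type']
  refine Finset.sum_congr rfl fun x _ => ?_
  rw [Pi.star_apply, ← Prod.mk.eta (p := x.1), ← Prod.mk.eta (p := x.2), hφ, hφ, star_sum]
  simp only [Finset.sum_mul, Finset.mul_sum]
  rw [Finset.sum_comm]
  refine Finset.sum_congr rfl fun r _ => Finset.sum_congr rfl fun t _ => ?_
  simp only [star_mul', Complex.star_def, Complex.conj_ofReal, Complex.conj_conj]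
  ring

/-- The eigenbasis (as rows) of the partial transpose of `∑ r, s r • e r ⊗ e r`: the vectors
`e i ⊗ e i`, and the normalized symmetric (`i < j`) and antisymmetric (`i > j`) combinations of
`e i ⊗ e j` and `e j ⊗ e i`. -/
def symBasis : Matrix QIdx QIdx ℂ :=
  fun p q =>
    if p.1 = p.2 then (if q = p then 1 else 0)
    else if p.1 < p.2 then (if q = p ∨ q = p.swap then ((√2)⁻¹ : ℝ) else 0)
    else (if q = p.swap then ((√2)⁻¹ : ℝ) else if q = p then -((√2)⁻¹ : ℝ) else 0)

/-- The eigenvalue of the partial transpose of `∑ r, s r • e r ⊗ e r` at the vector with index `p`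
of `symBasis`. -/
def schmidtWeight (s : Fin 3 → ℝ) (p : QIdx) : ℝ :=
  if p.1 ≤ p.2 then s p.1 * s p.2 else -(s p.1 * s p.2)

/-- A three-level spectrum: value `a` once, `b` three times and `c` five times. -/
def levels (a b c : ℝ) (p : QIdx) : ℝ :=
  if p = (1, 0) then a else if p = (2, 0) ∨ p = (2, 1) ∨ p = (2, 2) then b else c

theorem inv_sqrt_two_mul_self_complex : (((√2)⁻¹ : ℝ) : ℂ) * (((√2)⁻¹ : ℝ) : ℂ) = 1 / 2 := by
  rw [← Complex.ofReal_mul, ← mul_inv, Real.mul_self_sqrt (by norm_num)]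
  norm_num

theorem symBasis_apply_comm (p q : QIdx) : symBasis p q = symBasis q p := by
  obtain ⟨i, j⟩ := p
  obtain ⟨k, l⟩ := q
  fin_cases i <;> fin_cases j <;> fin_cases k <;> fin_cases l <;> simp [symBasis]

theorem symBasis_conjTranspose : symBasisᴴ = symBasis := by
  ext p q
  rw [conjTranspose_apply, ← symBasis_apply_comm]
  unfold symBasis
  split_ifs <;> simp

theorem symBasis_mul_self : symBasis * symBasis = 1 := by
  have h := inv_sqrt_two_mul_self_complex
  rw [Complex.ofReal_inv] at h
  ext p q
  obtain ⟨i, j⟩ := p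
  obtain ⟨k, l⟩ := q
  fin_cases i <;> fin_cases j <;> fin_cases k <;> fin_cases l <;>
    simp [symBasis, Matrix.mul_apply, Fintype.sum_prod_type, Fin.sum_univ_three, h, one_apply] <;>
    norm_num

theorem symBasis_mem_unitaryGroup : symBasis ∈ unitaryGroup QIdx ℂ := by
  rw [mem_unitaryGroup_iff, star_eq_conjTranspose, symBasis_conjTranspose, symBasis_mul_self]

theorem sum_schmidt_eq_sum_schmidtWeight (M : Matrix QIdx QIdx ℂ) (s : Fin 3 → ℝ) :
    ∑ r, ∑ t, (s r * s t : ℂ) * M (r, t) (t, r) =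
      ∑ p, (schmidtWeight s p : ℂ) * (symBasis * M * symBasisᴴ) p p := by
  have h := inv_sqrt_two_mul_self_complex
  rw [Complex.ofReal_inv] at h
  rw [symBasis_conjTranspose]
  simp [Fintype.sum_prod_type, Fin.sum_univ_three, schmidtWeight, Matrix.mul_apply, symBasis]
  linear_combination -2 * (s 0 * s 1 * (M (1, 0) (0, 1) + M (0, 1) (1, 0)) +
    s 0 * s 2 * (M (2, 0) (0, 2) + M (0, 2) (2, 0)) +
    s 1 * s 2 * (M (2, 1) (1, 2) + M (1, 2) (2, 1))) * h

theorem neg_mul_le_schmidtWeight {s : Fin 3 → ℝ} (h2 : 0 ≤ s 2) (h21 : s 2 ≤ s 1)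
    (h10 : s 1 ≤ s 0) (p : QIdx) : -(s 0 * s 1) ≤ schmidtWeight s p := by
  have h01 : s 1 * s 2 ≤ s 0 * s 1 := by nlinarith
  have h02 : s 0 * s 2 ≤ s 0 * s 1 := by nlinarith
  have h12 : 0 ≤ s 1 * s 2 := mul_nonneg (h2.trans h21) h2
  have hpos : ∀ i, 0 ≤ s i := fun i => by fin_cases i <;> simp <;> linarith
  obtain ⟨i, j⟩ := p
  unfold schmidtWeight
  split_ifs with h
  · linarith [mul_nonneg (hpos i) (hpos j)]
  · fin_cases i <;> fin_cases j <;> simp at h ⊢ <;> linarith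

theorem schmidtWeight_le_sq {s : Fin 3 → ℝ} (h2 : 0 ≤ s 2) (h21 : s 2 ≤ s 1)
    (h10 : s 1 ≤ s 0) {p : QIdx} (hp : p.2 < p.1) : schmidtWeight s p ≤ s 2 * s 2 := by
  have hpos : ∀ i, 0 ≤ s i := fun i => by fin_cases i <;> simp <;> linarith
  rw [schmidtWeight, if_neg (not_le.2 hp)]
  linarith [mul_nonneg (hpos p.1) (hpos p.2), mul_nonneg h2 h2]

theorem sq_le_schmidtWeight {s : Fin 3 → ℝ} (h2 : 0 ≤ s 2) (h21 : s 2 ≤ s 1)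
    (h10 : s 1 ≤ s 0) {p : QIdx} (hp : ¬ p.2 < p.1) : s 2 * s 2 ≤ schmidtWeight s p := by
  have hle : ∀ i, s 2 ≤ s i := fun i => by fin_cases i <;> simp <;> linarith
  rw [schmidtWeight, if_pos (not_lt.1 hp)]
  exact mul_le_mul (hle _) (hle _) h2 (h2.trans (hle _))

theorem sum_schmidtWeight_mul_nonneg {a b c : ℝ} (hc : 0 ≤ c) (hcb : c ≤ b) (hba : b ≤ a)
    (hb : 0 < b) (hdet : (3 * c - a) * b = (b - c) ^ 2) {s : Fin 3 → ℝ} (h2 : 0 ≤ s 2)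
    (h21 : s 2 ≤ s 1) (h10 : s 1 ≤ s 0) {N : QIdx → QIdx → ℝ} (hN : ∀ p q, 0 ≤ N p q)
    (hrow : ∀ p, ∑ q, N p q = 1) (hcol : ∀ q, ∑ p, N p q = 1) :
    0 ≤ ∑ p, schmidtWeight s p * ∑ q, N p q * levels a b c q := by
  obtain ⟨z, hz⟩ : ∃ z : QIdx → ℝ, z = fun p => N p (1, 0) := ⟨_, rfl⟩
  obtain ⟨y, hy⟩ : ∃ y : QIdx → ℝ,
    y = fun p => N p (1, 0) + N p (2, 0) + N p (2, 1) + N p (2, 2) := ⟨_, rfl⟩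
  have hz0 : ∀ p, 0 ≤ z p := fun p => hz ▸ hN p _
  have hy0 : ∀ p, 0 ≤ y p := fun p => by
    rw [hy]; linarith [hN p (1, 0), hN p (2, 0), hN p (2, 1), hN p (2, 2)]
  have hy1 : ∀ p, y p ≤ 1 := fun p => by
    have h := hrow p
    simp only [Fintype.sum_prod_type, Fin.sum_univ_three] at h
    rw [hy]; linarith [hN p (0, 0), hN p (0, 1), hN p (0, 2), hN p (1, 1), hN p (1, 2)]
  have hzs : ∑ p, z p = 1 := hz ▸ hcol _
  have hys : ∑ p, y p = 4 := by
    rw [hy]; simp only [Finset.sum_add_distrib, hcol]; norm_num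
  have hsum : ∀ p, ∑ q, N p q * levels a b c q = c + (b - c) * y p + (a - b) * z p := fun p => by
    have h := hrow p
    simp only [Fintype.sum_prod_type, Fin.sum_univ_three] at h ⊢
    simp [hz, hy, levels]
    linear_combination c * h
  simp only [hsum, mul_add, Finset.sum_add_distrib, ← Finset.sum_mul]
  have hw : ∑ p, schmidtWeight s p = s 0 ^ 2 + s 1 ^ 2 + s 2 ^ 2 := by
    simp [Fintype.sum_prod_type, Fin.sum_univ_three, schmidtWeight]
    ring
  have hwz : -(s 0 * s 1) ≤ ∑ p, schmidtWeight s p * z p := by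
    calc -(s 0 * s 1) = ∑ p, -(s 0 * s 1) * z p := by rw [← Finset.mul_sum, hzs, mul_one]
      _ ≤ _ := by
        refine Finset.sum_le_sum fun p _ => mul_le_mul_of_nonneg_right ?_ (hz0 p)
        exact neg_mul_le_schmidtWeight h2 h21 h10 p
  have hwy : s 2 * s 2 - s 0 * s 1 - s 0 * s 2 - s 1 * s 2 ≤ ∑ p, schmidtWeight s p * y p := by
    have hle : ∀ p : QIdx, (if p.2 < p.1 then schmidtWeight s p - s 2 * s 2 else 0) ≤
        (schmidtWeight s p - s 2 * s 2) * y p := fun p => by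
      split_ifs with h
      · nlinarith [hy1 p, schmidtWeight_le_sq h2 h21 h10 h]
      · exact mul_nonneg (sub_nonneg.2 (sq_le_schmidtWeight h2 h21 h10 h)) (hy0 p)
    have h := Finset.sum_le_sum fun p (_ : p ∈ Finset.univ) => hle p
    simp only [sub_mul, Finset.sum_sub_distrib, ← Finset.mul_sum, hys] at h
    have h4 : ∑ p : QIdx, (if p.2 < p.1 then schmidtWeight s p - s 2 * s 2 else 0) =
        -(s 0 * s 1) - s 0 * s 2 - s 1 * s 2 - 3 * (s 2 * s 2) := by
      simp [Fintype.sum_prod_type, Fin.sum_univ_three, schmidtWeight]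
      ring
    linarith
  have hq2 : 0 ≤ c * (s 0 ^ 2 + s 1 ^ 2 + s 2 ^ 2) + (b - c) *
      (s 2 * s 2 - s 0 * s 1 - s 0 * s 2 - s 1 * s 2) + (a - b) * -(s 0 * s 1) := by
    refine nonneg_of_mul_nonneg_right (a := b) ?_ hb
    nlinarith [sq_nonneg (2 * b * s 2 - (b - c) * (s 0 + s 1)),
      mul_nonneg (mul_nonneg hb.le (by linarith : 0 ≤ a + c)) (sq_nonneg (s 0 - s 1))]
  have hy3 := mul_le_mul_of_nonneg_left hwy (sub_nonneg.2 hcb)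
  have hz3 := mul_le_mul_of_nonneg_left hwz (sub_nonneg.2 hba)
  rw [Finset.mul_sum] at hy3 hz3
  rw [hw]
  simp only [mul_left_comm (schmidtWeight s _)]
  linarith

theorem conj_mem_AP33 {σ : Matrix QIdx QIdx ℂ} (h : σ ∈ AP33) {W : Matrix QIdx QIdx ℂ}
    (hW : W ∈ unitaryGroup QIdx ℂ) : W * σ * Wᴴ ∈ AP33 := by
  obtain ⟨hpos, htr, hPT⟩ := h
  refine ⟨hpos.mul_mul_conjTranspose_same W, ?_, fun U hU => ?_⟩
  · rw [trace_mul_comm, ← Matrix.mul_assoc, ← star_eq_conjTranspose, mem_unitaryGroup_iff'.1 hW,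
      Matrix.one_mul, htr]
  · have h := hPT (U * W) (mul_mem hU hW)
    rwa [conjTranspose_mul, show U * W * σ * (Wᴴ * Uᴴ) = U * (W * σ * Wᴴ) * Uᴴ by
      simp only [Matrix.mul_assoc]] at h

theorem posSemidef_PT_of_mem_AP33 {σ : Matrix QIdx QIdx ℂ} (h : σ ∈ AP33) :
    (PT σ).PosSemidef := by
  simpa using h.2.2 1 (one_mem _)

theorem isHermitian_PT {M : Matrix QIdx QIdx ℂ} (hM : M.IsHermitian) : (PT M).IsHermitian := by
  ext p q
  exact hM.apply _ _

theorem mul_diagonal_mul_conjTranspose_apply_self {n : Type*} [Fintype n] [DecidableEq n]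
    (V : Matrix n n ℂ) (r : n → ℝ) (p : n) :
    (V * diagonal (fun q => (r q : ℂ)) * Vᴴ) p p = ((∑ q, ‖V p q‖ ^ 2 * r q : ℝ) : ℂ) := by
  rw [Matrix.mul_apply]
  push_cast
  refine Finset.sum_congr rfl fun q _ => ?_
  rw [mul_diagonal, conjTranspose_apply, mul_right_comm, Complex.star_def, Complex.mul_conj']

theorem sum_sq_norm_row_of_mem_unitaryGroup {n : Type*} [Fintype n] [DecidableEq n]
    {V : Matrix n n ℂ} (hV : V ∈ unitaryGroup n ℂ) (p : n) : ∑ q, ‖V p q‖ ^ 2 = 1 := by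
  have h := mul_diagonal_mul_conjTranspose_apply_self V 1 p
  simp only [Pi.one_apply, Complex.ofReal_one, mul_one, diagonal_one] at h
  rw [← star_eq_conjTranspose, mem_unitaryGroup_iff.1 hV, one_apply_eq] at h
  exact_mod_cast h.symm

/-- The parameters of a three-level state whose Hildebrand matrix is singular. -/
structure IsBoundaryLevels (a b c : ℝ) : Prop where
  pos : 0 < c
  lt : c < b
  le : b ≤ a
  sum_eq : a + 3 * b + 5 * c = 1
  det_eq : (3 * c - a) * b = (b - c) ^ 2

/-- The state diagonal in the computational basis with spectrum `levels a b c`. -/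
def levelState (a b c : ℝ) : Matrix QIdx QIdx ℂ :=
  diagonal fun p => (levels a b c p : ℂ)

theorem levelState_mem_AP33 {a b c : ℝ} (h : IsBoundaryLevels a b c) :
    levelState a b c ∈ AP33 := by
  have hb : 0 < b := h.pos.trans h.lt
  have hpos : (levelState a b c).PosSemidef := by
    refine PosSemidef.diagonal fun p => ?_
    have : 0 ≤ levels a b c p := by
      unfold levels
      split_ifs
      exacts [hb.le.trans h.le, hb.le, h.pos.le]
    exact Complex.zero_le_real.2 this
  refine ⟨hpos, ?_, fun W hW => PosSemidef.of_dotProduct_mulVec_nonneg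
    (isHermitian_PT (hpos.mul_mul_conjTranspose_same W).isHermitian) fun φ => ?_⟩
  · have := congrArg (fun t : ℝ => (t : ℂ)) h.sum_eq
    simp [levelState, trace, Fintype.sum_prod_type, Fin.sum_univ_three, levels] at this ⊢
    linear_combination this
  · obtain ⟨s, U, V, h2, h21, h10, hU, hV, hφ⟩ := exists_schmidt_decomposition φ
    rw [quadForm_PT_schmidt _ s U V φ hφ, sum_schmidt_eq_sum_schmidtWeight]
    have hK : kroneckerMap (· * ·) U V ∈ unitaryGroup QIdx ℂ := kronecker_mem_unitary hU hV
    generalize kroneckerMap (· * ·) U V = K at hK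
    have hX : symBasis * Kᴴ * W ∈ unitaryGroup QIdx ℂ :=
      mul_mem (mul_mem symBasis_mem_unitaryGroup (Unitary.star_mem hK)) hW
    rw [show symBasis * (Kᴴ * (W * levelState a b c * Wᴴ) * K) * symBasisᴴ =
      (symBasis * Kᴴ * W) * levelState a b c * (symBasis * Kᴴ * W)ᴴ by
        simp only [conjTranspose_mul, conjTranspose_conjTranspose, Matrix.mul_assoc]]
    generalize symBasis * Kᴴ * W = X at hX
    simp only [levelState, mul_diagonal_mul_conjTranspose_apply_self]
    have hmain := sum_schmidtWeight_mul_nonneg h.pos.le h.lt.le h.le hb h.det_eq h2 h21 h10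
      (N := fun p q => ‖X p q‖ ^ 2) (fun _ _ => sq_nonneg _)
      (sum_sq_norm_row_of_mem_unitaryGroup hX) (fun q => by
        simpa [star_eq_conjTranspose] using
          sum_sq_norm_row_of_mem_unitaryGroup (Unitary.star_mem hX) q)
    exact_mod_cast hmain

/-- `σ` lies in the minimal face of `AP33` containing `ρ`. -/
def InFace (ρ σ : Matrix QIdx QIdx ℂ) : Prop :=
  σ ∈ AP33 ∧ ∃ τ ∈ AP33, ρ ∈ openSegment ℝ σ τ

theorem InFace.conj {ρ σ : Matrix QIdx QIdx ℂ} (h : InFace ρ σ) {W : Matrix QIdx QIdx ℂ}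
    (hW : W ∈ unitaryGroup QIdx ℂ) : InFace (W * ρ * Wᴴ) (W * σ * Wᴴ) := by
  obtain ⟨hσ, τ, hτ, t, u, ht, hu, htu, rfl⟩ := h
  refine ⟨conj_mem_AP33 hσ hW, _, conj_mem_AP33 hτ hW, t, u, ht, hu, htu, ?_⟩
  simp [Matrix.mul_add, Matrix.add_mul]

theorem InFace.PT_mulVec_eq_zero {ρ σ : Matrix QIdx QIdx ℂ} (h : InFace ρ σ) {φ : QIdx → ℂ}
    (hφ : star φ ⬝ᵥ PT ρ *ᵥ φ = 0) : PT σ *ᵥ φ = 0 := by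
  obtain ⟨hσ, τ, hτ, t, u, ht, hu, htu, rfl⟩ := h
  have h1 := posSemidef_PT_of_mem_AP33 hσ
  have h2 := posSemidef_PT_of_mem_AP33 hτ
  have hsplit : PT (t • σ + u • τ) = t • PT σ + u • PT τ := rfl
  rw [← h1.dotProduct_mulVec_zero_iff]
  rw [hsplit, add_mulVec, smul_mulVec, smul_mulVec, dotProduct_add, dotProduct_smul,
    dotProduct_smul] at hφ
  have h3 := (add_eq_zero_iff_of_nonneg (smul_nonneg ht.le (h1.dotProduct_mulVec_nonneg φ))
    (smul_nonneg hu.le (h2.dotProduct_mulVec_nonneg φ))).1 hφ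
  exact (smul_eq_zero.1 h3.1).resolve_left (ne_of_gt ht)

/-- The linear equations cut out by the null vector of the partial transpose. -/
theorem InFace.sum_eq_zero {a b c : ℝ} (h : IsBoundaryLevels a b c) {σ : Matrix QIdx QIdx ℂ}
    (hσ : InFace (levelState a b c) σ) (i j : Fin 3) :
    ∑ k, ((![1, 1, (b - c) / b] : Fin 3 → ℝ) k : ℂ) *
      (symBasis * σ * symBasisᴴ) (i, k) (k, j) = 0 := by
  have hb : b ≠ 0 := (h.pos.trans h.lt).ne'
  obtain ⟨s, hs⟩ : ∃ s : Fin 3 → ℝ, s = ![1, 1, (b - c) / b] := ⟨_, rfl⟩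
  rw [← hs]
  let φ : QIdx → ℂ := fun p => if p.1 = p.2 then (s p.1 : ℂ) else 0
  have hφ : ∀ i j, φ (i, j) = ∑ r, (s r : ℂ) * (1 : Matrix (Fin 3) (Fin 3) ℂ) i r *
      star ((1 : Matrix (Fin 3) (Fin 3) ℂ) j r) := fun i j => by
    by_cases hij : i = j <;> simp [φ, one_apply, hij]
  have hnull := (hσ.conj symBasis_mem_unitaryGroup).PT_mulVec_eq_zero (φ := φ) (by
    rw [quadForm_PT_schmidt _ s 1 1 φ hφ, sum_schmidt_eq_sum_schmidtWeight]
    have hone : kroneckerMap (· * ·) (1 : Matrix (Fin 3) (Fin 3) ℂ)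
      (1 : Matrix (Fin 3) (Fin 3) ℂ) = 1 := kroneckerMap_one_one _ (by simp) (by simp) (by simp)
    rw [hone, conjTranspose_one, Matrix.one_mul, Matrix.mul_one, symBasis_conjTranspose,
      show symBasis * (symBasis * levelState a b c * symBasis) * symBasis =
        (symBasis * symBasis) * levelState a b c * (symBasis * symBasis) by
        simp only [Matrix.mul_assoc], symBasis_mul_self, Matrix.one_mul, Matrix.mul_one]
    have hreal : ∑ p, schmidtWeight s p * levels a b c p = 0 := by
      have hdet := h.det_eq
      simp [Fintype.sum_prod_type, Fin.sum_univ_three, schmidtWeight, levels, hs]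
      field_simp
      linear_combination hdet
    simp only [levelState, diagonal_apply_eq]
    exact_mod_cast hreal)
  have hij := congrFun hnull (i, j)
  simp only [mulVec, dotProduct, Fintype.sum_prod_type, φ, PT, Pi.zero_apply] at hij
  rw [← hij]
  refine Finset.sum_congr rfl fun k _ => ?_
  simp [mul_comm]

theorem InFace.equation_zero_one {a b c : ℝ} (h : IsBoundaryLevels a b c)
    {σ : Matrix QIdx QIdx ℂ} (hσ : InFace (levelState a b c) σ) :
    (((√2)⁻¹ : ℝ) : ℂ) * (σ (0, 0) (0, 1) + σ (0, 0) (1, 0)) +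
      (((√2)⁻¹ : ℝ) : ℂ) * (σ (0, 1) (1, 1) + σ (1, 0) (1, 1)) +
      ((b - c) / b : ℂ) * (1 / 2) * (σ (0, 2) (1, 2) - σ (0, 2) (2, 1) + σ (2, 0) (1, 2)
        - σ (2, 0) (2, 1)) = 0 := by
  have h1 := hσ.sum_eq_zero h 0 1
  have h2 := inv_sqrt_two_mul_self_complex
  rw [Complex.ofReal_inv] at h2
  simp [symBasis_conjTranspose, Fintype.sum_prod_type, Fin.sum_univ_three, Matrix.mul_apply,
    symBasis] at h1 ⊢
  linear_combination h1 - ((b - c) / b : ℂ) * (σ (0, 2) (1, 2) - σ (0, 2) (2, 1) +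
    σ (2, 0) (1, 2) - σ (2, 0) (2, 1)) * h2

theorem InFace.equation_zero_two {a b c : ℝ} (h : IsBoundaryLevels a b c)
    {σ : Matrix QIdx QIdx ℂ} (hσ : InFace (levelState a b c) σ) :
    (((√2)⁻¹ : ℝ) : ℂ) * (σ (0, 0) (0, 2) + σ (0, 0) (2, 0)) +
      1 / 2 * (σ (0, 1) (1, 2) + σ (0, 1) (2, 1) + σ (1, 0) (1, 2) + σ (1, 0) (2, 1)) +
      ((b - c) / b : ℂ) * (((√2)⁻¹ : ℝ) : ℂ) * (σ (0, 2) (2, 2) + σ (2, 0) (2, 2)) = 0 := by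
  have h1 := hσ.sum_eq_zero h 0 2
  have h2 := inv_sqrt_two_mul_self_complex
  rw [Complex.ofReal_inv] at h2
  simp [symBasis_conjTranspose, Fintype.sum_prod_type, Fin.sum_univ_three, Matrix.mul_apply,
    symBasis] at h1 ⊢
  linear_combination h1 - (σ (0, 1) (1, 2) + σ (0, 1) (2, 1) + σ (1, 0) (1, 2)
    + σ (1, 0) (2, 1)) * h2

theorem InFace.equation_zero_zero {a b c : ℝ} (h : IsBoundaryLevels a b c)
    {σ : Matrix QIdx QIdx ℂ} (hσ : InFace (levelState a b c) σ) (hd : ∀ p q, p ≠ q → σ p q = 0) :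
    σ (0, 0) (0, 0) + 1 / 2 * (σ (0, 1) (0, 1) - σ (1, 0) (1, 0)) +
      ((b - c) / b : ℂ) * (1 / 2) * (σ (0, 2) (0, 2) - σ (2, 0) (2, 0)) = 0 := by
  have h1 := hσ.sum_eq_zero h 0 0
  have h2 := inv_sqrt_two_mul_self_complex
  rw [Complex.ofReal_inv] at h2
  simp [symBasis_conjTranspose, Fintype.sum_prod_type, Fin.sum_univ_three, Matrix.mul_apply,
    symBasis, hd] at h1 ⊢
  linear_combination h1 - (σ (0, 1) (0, 1) - σ (1, 0) (1, 0) +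
      ((b - c) / b : ℂ) * (σ (0, 2) (0, 2) - σ (2, 0) (2, 0))) * h2

theorem InFace.equation_two_two {a b c : ℝ} (h : IsBoundaryLevels a b c)
    {σ : Matrix QIdx QIdx ℂ} (hσ : InFace (levelState a b c) σ) (hd : ∀ p q, p ≠ q → σ p q = 0) :
    1 / 2 * (σ (0, 2) (0, 2) - σ (2, 0) (2, 0) + σ (1, 2) (1, 2) - σ (2, 1) (2, 1)) +
      ((b - c) / b : ℂ) * σ (2, 2) (2, 2) = 0 := by
  have h1 := hσ.sum_eq_zero h 2 2
  have h2 := inv_sqrt_two_mul_self_complex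
  rw [Complex.ofReal_inv] at h2
  simp [symBasis_conjTranspose, Fintype.sum_prod_type, Fin.sum_univ_three, Matrix.mul_apply,
    symBasis, hd] at h1 ⊢
  linear_combination h1 - (σ (0, 2) (0, 2) - σ (2, 0) (2, 0) + σ (1, 2) (1, 2)
    - σ (2, 1) (2, 1)) * h2

theorem submatrix_mem_unitaryGroup_of_perm {n : Type*} [Fintype n] [DecidableEq n]
    (e : Equiv.Perm n) : (1 : Matrix n n ℂ).submatrix e id ∈ unitaryGroup n ℂ := by
  rw [mem_unitaryGroup_iff, star_eq_conjTranspose, conjTranspose_submatrix, conjTranspose_one,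
    ← Equiv.coe_refl, submatrix_mul_equiv, Matrix.mul_one, submatrix_one_equiv]

theorem submatrix_one_mul_mul_conjTranspose {n : Type*} [Fintype n] [DecidableEq n]
    (e : Equiv.Perm n) (σ : Matrix n n ℂ) :
    (1 : Matrix n n ℂ).submatrix e id * σ * ((1 : Matrix n n ℂ).submatrix e id)ᴴ =
      σ.submatrix e e := by
  ext p q
  simp [Matrix.mul_apply, one_apply]

theorem InFace.submatrix {a b c : ℝ} {σ : Matrix QIdx QIdx ℂ}
    (hσ : InFace (levelState a b c) σ) {e : Equiv.Perm QIdx}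
    (he : ∀ p, levels a b c (e p) = levels a b c p) :
    InFace (levelState a b c) (σ.submatrix e e) := by
  have h := hσ.conj (submatrix_mem_unitaryGroup_of_perm e)
  rw [submatrix_one_mul_mul_conjTranspose, submatrix_one_mul_mul_conjTranspose] at h
  rwa [levelState, submatrix_diagonal_equiv, show (fun p => (levels a b c p : ℂ)) ∘ e =
    fun p => (levels a b c p : ℂ) from funext fun p => by simp [he]] at h

theorem InFace.sign_flip {a b c : ℝ} {σ : Matrix QIdx QIdx ℂ}
    (hσ : InFace (levelState a b c) σ) (m : QIdx) :
    InFace (levelState a b c)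
      (Matrix.of fun p q => (if p = m then -1 else 1) * σ p q * (if q = m then -1 else 1)) := by
  let D : Matrix QIdx QIdx ℂ := diagonal fun p => if p = m then -1 else 1
  have hDH : Dᴴ = D := by
    simp only [D, diagonal_conjTranspose]
    congr 1
    ext p
    by_cases hp : p = m <;> simp [hp]
  have hDD : D * D = 1 := by
    simp only [D, diagonal_mul_diagonal, ← diagonal_one]
    congr 1
    ext p
    by_cases hp : p = m <;> simp [hp]
  have h := hσ.conj (W := D) (by rw [mem_unitaryGroup_iff, star_eq_conjTranspose, hDH, hDD])
  rw [hDH] at h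
  convert h using 1
  · ext p q
    by_cases hp : p = q
    · subst hp
      by_cases hm : p = m <;> simp [D, levelState, hm]
    · simp [D, levelState, hp]
  · ext p q
    simp [D]

theorem InFace.offDiag_templates {a b c : ℝ} (h : IsBoundaryLevels a b c)
    {σ : Matrix QIdx QIdx ℂ} (hσ : InFace (levelState a b c) σ) :
    σ (0, 0) (1, 0) = 0 ∧ σ (0, 0) (0, 1) = 0 ∧ σ (2, 0) (1, 2) = 0 ∧ σ (2, 0) (2, 1) = 0 ∧
      σ (1, 0) (2, 1) = 0 := by
  have hs : (((√2)⁻¹ : ℝ) : ℂ) ≠ 0 := by simp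
  have hx : ((b - c) / b : ℂ) ≠ 0 := by
    have := h.lt
    have := h.pos
    exact_mod_cast (div_pos (by linarith) (by linarith) : 0 < (b - c) / b).ne'
  have hflip := hσ.sign_flip
  have hflip2 := fun m => (hflip m).sign_flip
  refine ⟨?_, ?_, ?_, ?_, ?_⟩
  · have h0 := hσ.equation_zero_one h
    have h1 := (hflip (0, 0)).equation_zero_one h
    have h2 := (hflip (1, 0)).equation_zero_one h
    have h3 := (hflip2 (0, 0) (1, 0)).equation_zero_one h
    simp at h0 h1 h2 h3
    refine (mul_eq_zero.1 ?_).resolve_left hs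
    push_cast
    linear_combination (h0 - h1 - h2 + h3) / 4
  · have h0 := hσ.equation_zero_one h
    have h1 := (hflip (0, 0)).equation_zero_one h
    have h2 := (hflip (0, 1)).equation_zero_one h
    have h3 := (hflip2 (0, 0) (0, 1)).equation_zero_one h
    simp at h0 h1 h2 h3
    refine (mul_eq_zero.1 ?_).resolve_left hs
    push_cast
    linear_combination (h0 - h1 - h2 + h3) / 4
  · have h0 := hσ.equation_zero_one h
    have h1 := (hflip (2, 0)).equation_zero_one h
    have h2 := (hflip (1, 2)).equation_zero_one h
    have h3 := (hflip2 (2, 0) (1, 2)).equation_zero_one h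
    simp at h0 h1 h2 h3
    refine (mul_eq_zero.1 ?_).resolve_left hx
    linear_combination (h0 - h1 - h2 + h3) / 2
  · have h0 := hσ.equation_zero_one h
    have h1 := (hflip (2, 0)).equation_zero_one h
    have h2 := (hflip (2, 1)).equation_zero_one h
    have h3 := (hflip2 (2, 0) (2, 1)).equation_zero_one h
    simp at h0 h1 h2 h3
    refine (mul_eq_zero.1 ?_).resolve_left hx
    linear_combination -(h0 - h1 - h2 + h3) / 2
  · have h0 := hσ.equation_zero_two h
    have h1 := (hflip (1, 0)).equation_zero_two h
    have h2 := (hflip (2, 1)).equation_zero_two h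
    have h3 := (hflip2 (1, 0) (2, 1)).equation_zero_two h
    simp at h0 h1 h2 h3
    linear_combination (h0 - h1 - h2 + h3) / 2

theorem levels_swap {a b c : ℝ} {u v : QIdx} (huv : levels a b c u = levels a b c v) (p : QIdx) :
    levels a b c (Equiv.swap u v p) = levels a b c p := by
  rw [Equiv.swap_apply_def]
  split_ifs with h1 h2
  · rw [h1, huv]
  · rw [h2, huv]
  · rfl

theorem exists_perm_levels {a b c : ℝ} {m n p q : QIdx} (hmn : m ≠ n) (hpq : p ≠ q)
    (hm : levels a b c m = levels a b c p) (hn : levels a b c n = levels a b c q) :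
    ∃ e : Equiv.Perm QIdx, e m = p ∧ e n = q ∧ ∀ r, levels a b c (e r) = levels a b c r := by
  refine ⟨Equiv.swap (Equiv.swap m p n) q * Equiv.swap m p, ?_, ?_, fun r => ?_⟩
  · rw [Equiv.Perm.mul_apply, Equiv.swap_apply_left, Equiv.swap_apply_of_ne_of_ne _ hpq]
    intro h
    exact hmn ((Equiv.swap m p).injective (by rw [Equiv.swap_apply_left, ← h]))
  · rw [Equiv.Perm.mul_apply, Equiv.swap_apply_left]
  · rw [Equiv.Perm.mul_apply, levels_swap (by rw [levels_swap hm, hn]), levels_swap hm]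

theorem InFace.isHermitian {ρ σ : Matrix QIdx QIdx ℂ} (hσ : InFace ρ σ) : σ.IsHermitian :=
  hσ.1.1.isHermitian

theorem levels_trichotomy (a b c : ℝ) (p : QIdx) :
    p = (1, 0) ∨ levels a b c p = b ∨ levels a b c p = c := by
  unfold levels
  split_ifs with h1 <;> simp [h1]

theorem InFace.apply_eq_zero_of_ne {a b c : ℝ} (h : IsBoundaryLevels a b c)
    {σ : Matrix QIdx QIdx ℂ} (hσ : InFace (levelState a b c) σ) {p q : QIdx} (hpq : p ≠ q) :
    σ p q = 0 := by
  have transfer : ∀ {m n p q : QIdx}, (∀ τ, InFace (levelState a b c) τ → τ m n = 0) → m ≠ n →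
      p ≠ q → levels a b c m = levels a b c p → levels a b c n = levels a b c q →
      σ p q = 0 ∧ σ q p = 0 := by
    intro m n p q hT hmn hpq hm hn
    obtain ⟨e, rfl, rfl, he⟩ := exists_perm_levels hmn hpq hm hn
    have h0 : σ (e m) (e n) = 0 := hT _ (hσ.submatrix he)
    exact ⟨h0, by rw [← hσ.isHermitian.apply, h0, star_zero]⟩
  have ac := fun τ hτ => (InFace.offDiag_templates h (σ := τ) hτ).1
  have cc := fun τ hτ => (InFace.offDiag_templates h (σ := τ) hτ).2.1
  have bc := fun τ hτ => (InFace.offDiag_templates h (σ := τ) hτ).2.2.1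
  have bb := fun τ hτ => (InFace.offDiag_templates h (σ := τ) hτ).2.2.2.1
  have ab := fun τ hτ => (InFace.offDiag_templates h (σ := τ) hτ).2.2.2.2
  rcases levels_trichotomy a b c p with hp | hp | hp <;>
    rcases levels_trichotomy a b c q with hq | hq | hq
  · exact absurd (hp.trans hq.symm) hpq
  · exact (transfer ab (by decide) hpq (by rw [hp]) (by rw [hq]; simp [levels])).1
  · exact (transfer ac (by decide) hpq.symm (by rw [hq]; simp [levels]) (by rw [hp])).2
  · exact (transfer ab (by decide) hpq.symm (by rw [hq]) (by rw [hp]; simp [levels])).2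
  · exact (transfer bb (by decide) hpq (by rw [hp]; simp [levels]) (by rw [hq]; simp [levels])).1
  · exact (transfer bc (by decide) hpq (by rw [hp]; simp [levels]) (by rw [hq]; simp [levels])).1
  · exact (transfer ac (by decide) hpq (by rw [hp]; simp [levels]) (by rw [hq])).1
  · exact (transfer bc (by decide) hpq.symm (by rw [hq]; simp [levels]) (by rw [hp]; simp [levels])).2
  · exact (transfer cc (by decide) hpq (by rw [hp]; simp [levels]) (by rw [hq]; simp [levels])).1

theorem InFace.diag_eq_of_levels_eq {a b c : ℝ} (h : IsBoundaryLevels a b c)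
    {σ : Matrix QIdx QIdx ℂ} (hσ : InFace (levelState a b c) σ) :
    σ (2, 0) (2, 0) = σ (2, 2) (2, 2) ∧ σ (2, 1) (2, 1) = σ (2, 2) (2, 2) ∧
      ∀ p, levels a b c p = c → p ≠ (0, 0) → σ p p = σ (0, 0) (0, 0) := by
  have swapped : ∀ {u v : QIdx}, levels a b c u = levels a b c v →
      InFace (levelState a b c) (σ.submatrix (Equiv.swap u v) (Equiv.swap u v)) :=
    fun huv => hσ.submatrix (levels_swap huv)
  have hd : ∀ τ, InFace (levelState a b c) τ → ∀ p q, p ≠ q → τ p q = 0 :=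
    fun τ hτ p q hpq => hτ.apply_eq_zero_of_ne h hpq
  have hx : (1 / 2 + ((b - c) / b : ℂ)) ≠ 0 := by
    have hlt := h.lt
    have hpos := h.pos
    have hdiv : 0 < (b - c) / b := div_pos (by linarith) (by linarith)
    have hne : ((1 / 2 + (b - c) / b : ℝ) : ℂ) ≠ 0 :=
      Complex.ofReal_ne_zero.2 (by positivity)
    push_cast at hne
    exact hne
  have h0 := hσ.equation_two_two h (hd _ hσ)
  refine ⟨?_, ?_, fun p hp hp0 => ?_⟩
  · have hs := swapped (u := (2, 0)) (v := (2, 2)) (by simp [levels])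
    have h1 := hs.equation_two_two h (hd _ hs)
    simp [Equiv.swap_apply_def] at h1
    refine sub_eq_zero.1 ((mul_eq_zero.1 ?_).resolve_left hx)
    linear_combination h1 - h0
  · have hs := swapped (u := (2, 1)) (v := (2, 2)) (by simp [levels])
    have h1 := hs.equation_two_two h (hd _ hs)
    simp [Equiv.swap_apply_def] at h1
    refine sub_eq_zero.1 ((mul_eq_zero.1 ?_).resolve_left hx)
    linear_combination h1 - h0
  · obtain ⟨e, he0, hep, he⟩ := exists_perm_levels (a := a) (b := b) (c := c) (m := (0, 2))
      (n := (0, 0)) (by decide) hp0 (by rw [hp]; simp [levels]) rfl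
    have hs := hσ.submatrix he
    have hs' := hs.submatrix (levels_swap (u := (0, 2)) (v := (0, 0)) (by simp [levels]))
    have h1 := hs.equation_two_two h (hd _ hs)
    have h2 := hs'.equation_two_two h (hd _ hs')
    simp [Equiv.swap_apply_def] at h1 h2
    rw [he0] at h1
    rw [hep] at h2
    linear_combination 2 * (h1 - h2)

theorem InFace.eq_levelState {a b c : ℝ} (h : IsBoundaryLevels a b c)
    {σ : Matrix QIdx QIdx ℂ} (hσ : InFace (levelState a b c) σ) : σ = levelState a b c := by
  have hd : ∀ p q, p ≠ q → σ p q = 0 := fun p q hpq => hσ.apply_eq_zero_of_ne h hpq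
  obtain ⟨hb0, hb1, hcp⟩ := hσ.diag_eq_of_levels_eq h
  have h00 := hσ.equation_zero_zero h hd
  have h22 := hσ.equation_two_two h hd
  have htr := hσ.1.2.1
  have h01 := hcp (0, 1) (by simp [levels]) (by decide)
  have h02 := hcp (0, 2) (by simp [levels]) (by decide)
  have h11 := hcp (1, 1) (by simp [levels]) (by decide)
  have h12 := hcp (1, 2) (by simp [levels]) (by decide)
  simp only [trace, diag_apply, Fintype.sum_prod_type, Fin.sum_univ_three] at htr
  rw [hb0, hb1, h01, h02, h11, h12] at htr
  rw [h01, h02, hb0] at h00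
  rw [h02, h12, hb0, hb1] at h22
  have hpos := h.pos
  have hlt := h.lt
  have hbR : 0 < b := hpos.trans hlt
  have hbC : (b : ℂ) ≠ 0 := by exact_mod_cast hbR.ne'
  have hsum : (a + 3 * b + 5 * c : ℂ) = 1 := by exact_mod_cast h.sum_eq
  have hdet : ((3 * c - a) * b : ℂ) = (b - c) ^ 2 := by exact_mod_cast h.det_eq
  field_simp at h00 h22
  generalize hγ0 : σ (0, 0) (0, 0) = γ at *
  generalize hβ0 : σ (2, 2) (2, 2) = β at *
  generalize hα : σ (1, 0) (1, 0) = α at *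
  have hγb : γ * b = β * c := by linear_combination h22 / 2
  have hαb : α * b = β * a := by
    refine mul_right_cancel₀ hbC ?_
    linear_combination -b * h00 + (3 * b + (b - c)) * hγb + β * hdet
  have hβ : β = b := by
    linear_combination b * htr - β * hsum - hαb - 5 * hγb
  have hγ : γ = c := mul_right_cancel₀ hbC (by rw [hγb, hβ, mul_comm])
  have hα' : α = a := mul_right_cancel₀ hbC (by rw [hαb, hβ, mul_comm])
  ext p q
  by_cases hpq : p = q
  · subst hpq
    obtain ⟨i, j⟩ := p
    fin_cases i <;> fin_cases j <;> simp [levelState, levels, *]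
  · rw [hd p q hpq, levelState, diagonal_apply_ne _ hpq]

theorem levelState_mem_extremePoints {a b c : ℝ} (h : IsBoundaryLevels a b c)
    {W : Matrix QIdx QIdx ℂ} (hW : W ∈ unitaryGroup QIdx ℂ) :
    W * levelState a b c * Wᴴ ∈ Set.extremePoints ℝ AP33 := by
  refine ⟨conj_mem_AP33 (levelState_mem_AP33 h) hW, fun σ hσ τ hτ hmem => ?_⟩
  have hWW : Wᴴ * W = 1 := mem_unitaryGroup_iff'.1 hW
  have hWW' : W * Wᴴ = 1 := mem_unitaryGroup_iff.1 hW
  have hface := InFace.conj ⟨hσ, τ, hτ, hmem⟩ (Unitary.star_mem hW)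
  rw [star_eq_conjTranspose, conjTranspose_conjTranspose, show
    Wᴴ * (W * levelState a b c * Wᴴ) * W = (Wᴴ * W) * levelState a b c * (Wᴴ * W) by
      simp only [Matrix.mul_assoc], hWW, Matrix.one_mul, Matrix.mul_one] at hface
  rw [← hface.eq_levelState h, show W * (Wᴴ * σ * W) * Wᴴ = (W * Wᴴ) * σ * (W * Wᴴ) by
      simp only [Matrix.mul_assoc], hWW', Matrix.one_mul, Matrix.mul_one]

/-- The reordering of the computational basis turning `levels a b c` into the ordered spectrum
`a, b, b, b, c, c, c, c, c`. -/
def spectrumOrder : Equiv.Perm QIdx :=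
  Equiv.ofBijective (fun p => (![![(1, 0), (2, 0), (2, 1)], ![(2, 2), (0, 0), (0, 1)],
    ![(0, 2), (1, 1), (1, 2)]] : Fin 3 → Fin 3 → QIdx) p.1 p.2) (by decide)

theorem diag9_eq_submatrix_levelState (a b c : ℝ) :
    diag9 ![a, b, b, b, c, c, c, c, c] =
      (levelState a b c).submatrix spectrumOrder spectrumOrder := by
  rw [levelState, submatrix_diagonal_equiv, diag9]
  congr 1
  ext p
  obtain ⟨i, j⟩ := p
  fin_cases i <;> fin_cases j <;> simp [spectrumOrder, levels, finProdFinEquiv]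

theorem isBoundaryLevels_of_mem_interval {c : ℝ} (h1 : (10 - √17) / 83 < c) (h2 : c < 1 / 11) :
    IsBoundaryLevels ((1 + 10 * c - 3 * √(108 * c ^ 2 - 20 * c + 1)) / 4)
      ((1 - 10 * c + √(108 * c ^ 2 - 20 * c + 1)) / 4) c := by
  have h17 : √17 ^ 2 = 17 := Real.sq_sqrt (by norm_num)
  have h17' : √17 < 5 := by rw [Real.sqrt_lt' (by norm_num)]; norm_num
  have h17'' : 4 < √17 := by rw [Real.lt_sqrt (by norm_num)]; norm_num
  have hs : √(108 * c ^ 2 - 20 * c + 1) ^ 2 = 108 * c ^ 2 - 20 * c + 1 :=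
    Real.sq_sqrt (by nlinarith [sq_nonneg (54 * c - 5)])
  have hs0 := Real.sqrt_nonneg (108 * c ^ 2 - 20 * c + 1)
  generalize √(108 * c ^ 2 - 20 * c + 1) = s at *
  have hc1 : 10 - √17 < 83 * c := by linarith
  have hc : 0 < c := by linarith
  have hsc : 14 * c - 1 < s := by
    refine lt_of_pow_lt_pow_left₀ 2 hs0 ?_
    nlinarith
  have hsc' : s ≤ 5 * c := by
    refine le_of_sq_le_sq ?_ (by linarith)
    nlinarith
  exact ⟨hc, by linarith, by linarith, by ring, by linear_combination hs / 8⟩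

/-- for (10−√17)/83 < c < 1/11, the state diag(a, b, b, b, c, c, c, c, c) with
a = (1+10c−3√(108c²−20c+1))/4 and b = (1−10c+√(108c²−20c+1))/4 is extreme in AP_{3,3}. -/
theorem nu135_extreme (c : ℝ)
    (h1 : (10 - Real.sqrt 17) / 83 < c) (h2 : c < 1 / 11) :
    diag9 ![(1 + 10 * c - 3 * Real.sqrt (108 * c ^ 2 - 20 * c + 1)) / 4,
        (1 - 10 * c + Real.sqrt (108 * c ^ 2 - 20 * c + 1)) / 4,
        (1 - 10 * c + Real.sqrt (108 * c ^ 2 - 20 * c + 1)) / 4,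
        (1 - 10 * c + Real.sqrt (108 * c ^ 2 - 20 * c + 1)) / 4, c, c, c, c, c]
      ∈ Set.extremePoints ℝ AP33 := by
  rw [diag9_eq_submatrix_levelState, ← submatrix_one_mul_mul_conjTranspose]
  exact levelState_mem_extremePoints (isBoundaryLevels_of_mem_interval h1 h2)
    (submatrix_mem_unitaryGroup_of_perm _)
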